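/- arXiv:1806.05797 — 5 statements merged into one kernel-verified Lean document; each statement's English description precedes it below -/
import Mathlib

section
/- Let d ≥ 1 and let H_1, …, H_n be hyperplanes in ℝ^d, i.e., H_i = {x ∈ ℝ^d : ⟨a_i, x⟩ = b_i} with a_i ∈ ℝ^d nonzero and b_i ∈ ℝ. Then the number of connected components of the complement ℝ^d \ (H_1 ∪ ⋯ ∪ H_n) is at most n^d/d! + (n+1)^{d−1}. -/
open RealInnerProductSpace

open Classical in
/-- The sets of affine inequalities `b i < ⟪a i, x⟫` satisfied at the points off all the
hyperplanes `⟪a i, x⟫ = b i`. -/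
noncomputable def positiveSideFamily {ι V : Type*} [Fintype ι]
    [NormedAddCommGroup V] [InnerProductSpace ℝ V] (a : ι → V) (b : ι → ℝ) :
    Finset (Finset ι) :=
  {s | ∃ x : V, (∀ i, ⟪a i, x⟫ ≠ b i) ∧ ∀ i, i ∈ s ↔ b i < ⟪a i, x⟫}

theorem mem_positiveSideFamily {ι V : Type*} [Fintype ι]
    [NormedAddCommGroup V] [InnerProductSpace ℝ V] {a : ι → V} {b : ι → ℝ} {s : Finset ι} :
    s ∈ positiveSideFamily a b ↔
      ∃ x : V, (∀ i, ⟪a i, x⟫ ≠ b i) ∧ ∀ i, i ∈ s ↔ b i < ⟪a i, x⟫ := by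
  simp [positiveSideFamily]

/-- A shattered set admits no nontrivial linear relation among its normal vectors. -/
theorem card_le_finrank_of_shatters {ι V : Type*} [Fintype ι] [DecidableEq ι]
    [NormedAddCommGroup V] [InnerProductSpace ℝ V] [FiniteDimensional ℝ V]
    {a : ι → V} {b : ι → ℝ} {s : Finset ι} (hs : (positiveSideFamily a b).Shatters s) :
    s.card ≤ Module.finrank ℝ V := by
  have key : ∀ c : s → ℝ, ∑ i, c i • a i = 0 → (∃ i, c i ≠ 0) → ∑ i, c i * b i < 0 := by
    rintro c hc ⟨j, hj⟩
    obtain ⟨u, hu, hsu⟩ := hs (Finset.filter_subset (fun i ↦ ∃ h : i ∈ s, 0 < c ⟨i, h⟩) s)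
    obtain ⟨x, hx, hxu⟩ := mem_positiveSideFamily.1 hu
    have hmem (i : s) : b i < ⟪a i, x⟫ ↔ 0 < c i := by
      have := congrArg ((i : ι) ∈ ·) hsu
      simpa [hxu] using this
    have hterm (i : s) (hi : c i ≠ 0) : 0 < c i * (⟪a i, x⟫ - b i) := by
      rcases lt_or_gt_of_ne hi with h | h
      · have hle : ⟪a i, x⟫ ≤ b i := not_lt.1 fun h' ↦ h.not_gt ((hmem i).1 h')
        exact mul_pos_of_neg_of_neg h (sub_neg.2 (lt_of_le_of_ne hle (hx i)))
      · exact mul_pos h (sub_pos.2 ((hmem i).2 h))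
    have hpos : 0 < ∑ i, c i * (⟪a i, x⟫ - b i) := by
      refine Finset.sum_pos' (fun i _ ↦ ?_) ⟨j, Finset.mem_univ j, hterm j hj⟩
      by_cases hi : c i = 0
      · simp [hi]
      · exact (hterm i hi).le
    have hzero : ∑ i, c i * ⟪a i, x⟫ = 0 := by
      simpa [sum_inner, real_inner_smul_left] using congrArg (⟪·, x⟫) hc
    simp only [mul_sub, Finset.sum_sub_distrib, hzero] at hpos
    linarith
  by_contra! hlt
  have hdep : ¬ LinearIndependent ℝ (fun i : s ↦ a i) := fun h ↦ by
    have := h.fintype_card_le_finrank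
    rw [Fintype.card_coe] at this
    omega
  obtain ⟨c, hc, j, hj⟩ := Fintype.not_linearIndependent_iff.1 hdep
  have h₁ := key c hc ⟨j, hj⟩
  have h₂ := key (-c) (by simpa using hc) ⟨j, by simpa using hj⟩
  simp only [Pi.neg_apply, neg_mul, Finset.sum_neg_distrib] at h₂
  linarith

theorem card_positiveSideFamily_le {ι V : Type*} [Fintype ι]
    [NormedAddCommGroup V] [InnerProductSpace ℝ V] [FiniteDimensional ℝ V]
    (a : ι → V) (b : ι → ℝ) :
    (positiveSideFamily a b).card ≤
      ∑ k ∈ Finset.range (Module.finrank ℝ V + 1), (Fintype.card ι).choose k := by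
  classical
  refine ((positiveSideFamily a b).card_le_card_shatterer.trans
    Finset.card_shatterer_le_sum_vcDim).trans ?_
  refine Finset.sum_le_sum_of_subset fun k hk ↦ ?_
  have hvc : (positiveSideFamily a b).vcDim ≤ Module.finrank ℝ V :=
    Finset.sup_le fun s hs ↦ card_le_finrank_of_shatters (Finset.mem_shatterer.1 hs)
  simp only [Finset.mem_Iic, Finset.mem_range] at hk ⊢
  omega

/-- Points on the same side of every hyperplane are joined by a segment avoiding all of them. -/
theorem card_connectedComponents_le_card_positiveSideFamily {ι V : Type*} [Fintype ι]
    [NormedAddCommGroup V] [InnerProductSpace ℝ V] (a : ι → V) (b : ι → ℝ) :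
    Nat.card (ConnectedComponents ↥((⋃ i, {x : V | ⟪a i, x⟫ = b i})ᶜ)) ≤
      (positiveSideFamily a b).card := by
  classical
  set U : Set V := (⋃ i, {x : V | ⟪a i, x⟫ = b i})ᶜ with hU
  have mem_U (x : V) : x ∈ U ↔ ∀ i, ⟪a i, x⟫ ≠ b i := by simp [hU]
  let side (x : U) : positiveSideFamily a b :=
    ⟨Finset.univ.filter fun i ↦ b i < ⟪a i, (x : V)⟫,
      mem_positiveSideFamily.2 ⟨x, (mem_U x).1 x.2, by simp⟩⟩
  have hside (x y : U) (hxy : side x = side y) :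
      (x : ConnectedComponents U) = (y : ConnectedComponents U) := by
    have hiff (i : ι) : b i < ⟪a i, (x : V)⟫ ↔ b i < ⟪a i, (y : V)⟫ := by
      simpa [side] using congrArg (i ∈ ·.1) hxy
    have hseg : segment ℝ (x : V) y ⊆ U := by
      rintro z ⟨p, q, hp, hq, hpq, rfl⟩
      refine (mem_U _).2 fun i ↦ ?_
      rw [inner_add_right, real_inner_smul_right, real_inner_smul_right]
      have hx := (mem_U x).1 x.2 i
      have hy := (mem_U y).1 y.2 i
      by_cases h : b i < ⟪a i, (x : V)⟫
      · exact ((convex_Ioi (b i)) h ((hiff i).1 h) hp hq hpq).ne'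
      · have hx' := lt_of_le_of_ne (not_lt.1 h) hx
        have hy' := lt_of_le_of_ne (not_lt.1 ((hiff i).not.1 h)) hy
        exact ((convex_Iio (b i)) hx' hy' hp hq hpq).ne
    have hconn : IsPreconnected ((↑) ⁻¹' segment ℝ (x : V) y : Set U) :=
      (Topology.IsInducing.subtypeVal.isPreconnected_image).1 <| by
        rw [Subtype.image_preimage_coe, Set.inter_eq_right.2 hseg]
        exact (convex_segment _ _).isPreconnected
    exact ConnectedComponents.coe_eq_coe'.2
      (hconn.subset_connectedComponent (right_mem_segment ℝ _ _) (left_mem_segment ℝ _ _))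
  have hinj : Function.Injective fun C : ConnectedComponents U ↦ side C.out := by
    intro C D h
    exact (Quotient.out_eq C).symm.trans ((hside _ _ h).trans (Quotient.out_eq D))
  simpa using Nat.card_le_card_of_injective _ hinj

theorem sum_range_choose_le_add_one_pow (n k : ℕ) :
    ∑ i ∈ Finset.range (k + 1), n.choose i ≤ (n + 1) ^ k := by
  rw [add_pow]
  refine Finset.sum_le_sum fun i hi ↦ ?_
  have : 1 ≤ k.choose i := Nat.choose_pos (Nat.lt_succ_iff.1 (Finset.mem_range.1 hi))
  simpa using Nat.mul_le_mul (Nat.choose_le_pow n i) this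

theorem card_components_hyperplane_arrangement_le
    {d n : ℕ} (hd : 1 ≤ d)
    (a : Fin n → EuclideanSpace ℝ (Fin d)) (ha : ∀ i, a i ≠ 0) (b : Fin n → ℝ) :
    (Nat.card
        (ConnectedComponents
          ↥((⋃ i : Fin n, {x : EuclideanSpace ℝ (Fin d) | ⟪a i, x⟫ = b i})ᶜ)) : ℝ) ≤
      (n : ℝ) ^ d / (Nat.factorial d) + ((n : ℝ) + 1) ^ (d - 1) := by
  have hcard := (card_connectedComponents_le_card_positiveSideFamily a b).trans
    (card_positiveSideFamily_le a b)
  rw [finrank_euclideanSpace_fin, Fintype.card_fin, Finset.sum_range_succ] at hcard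
  have hlow := sum_range_choose_le_add_one_pow n (d - 1)
  rw [Nat.sub_add_cancel hd] at hlow
  have htop : (n.choose d : ℝ) ≤ (n : ℝ) ^ d / (Nat.factorial d) := Nat.choose_le_pow_div d n
  have hlow' : ((∑ i ∈ Finset.range d, n.choose i : ℕ) : ℝ) ≤ ((n : ℝ) + 1) ^ (d - 1) := by
    exact_mod_cast hlow
  refine (Nat.cast_le.2 hcard).trans ?_
  rw [Nat.cast_add]
  linarith
end

section
/- Let d ≥ 1 and n ≥ 0. There exist hyperplanes H_1, …, H_n in ℝ^d (each of the form {x ∈ ℝ^d : ⟨a_i, x⟩ = b_i} with a_i ≠ 0) such that the complement ℝ^d \ (H_1 ∪ ⋯ ∪ H_n) has at least ⌊n/d⌋^d connected components. (Such a configuration is obtained by taking ⌊n/d⌋ hyperplanes parallel to each of the d coordinate hyperplanes.) -/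
open RealInnerProductSpace

/-- The complement of the union of the hyperplanes `⟪a i, x⟫ = b i`. -/
abbrev hyperplaneComplement {ι E : Type*} [NormedAddCommGroup E] [InnerProductSpace ℝ E]
    (a : ι → E) (b : ι → ℝ) : Set E :=
  (⋃ i, {x : E | ⟪a i, x⟫ = b i})ᶜ

section Regions

variable {ι E : Type*} [NormedAddCommGroup E] [InnerProductSpace ℝ E] {a : ι → E} {b : ι → ℝ}

theorem mem_hyperplaneComplement {x : E} :
    x ∈ hyperplaneComplement a b ↔ ∀ i, ⟪a i, x⟫ ≠ b i := by
  simp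

/-- Being on the positive side of one of the hyperplanes only depends on the region. -/
theorem lt_inner_iff_of_connectedComponents_eq {x y : hyperplaneComplement a b}
    (h : (x : ConnectedComponents (hyperplaneComplement a b)) = y) (i : ι) :
    b i < ⟪a i, (x : E)⟫ ↔ b i < ⟪a i, (y : E)⟫ := by
  have hcont : Continuous fun z : hyperplaneComplement a b => ⟪a i, (z : E)⟫ := by fun_prop
  have hclopen : IsClopen {z : hyperplaneComplement a b | b i < ⟪a i, (z : E)⟫} := by
    refine ⟨?_, isOpen_lt continuous_const hcont⟩
    convert isClosed_le continuous_const hcont using 3 with z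
    exact (mem_hyperplaneComplement.1 z.2 i).symm.le_iff_lt.symm
  rw [ConnectedComponents.coe_eq_coe] at h
  constructor
  · intro hx
    exact hclopen.connectedComponent_subset hx (h ▸ mem_connectedComponent)
  · intro hy
    exact hclopen.connectedComponent_subset hy (h ▸ mem_connectedComponent)

/-- Points on the same side of every hyperplane lie in the same region. -/
theorem connectedComponents_eq_of_lt_inner_iff {x y : hyperplaneComplement a b}
    (h : ∀ i, b i < ⟪a i, (x : E)⟫ ↔ b i < ⟪a i, (y : E)⟫) :
    (x : ConnectedComponents (hyperplaneComplement a b)) = y := by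
  have hseg : segment ℝ (x : E) y ⊆ hyperplaneComplement a b := by
    intro z hz
    rw [mem_hyperplaneComplement]
    intro i
    have hlin : IsLinearMap ℝ fun w : E => ⟪a i, w⟫ := (innerₛₗ ℝ (a i)).isLinear
    rcases (mem_hyperplaneComplement.1 x.2 i).lt_or_gt with hx | hx
    · have hy : ⟪a i, (y : E)⟫ < b i :=
        lt_of_le_of_ne (not_lt.1 fun hy => hx.not_gt ((h i).2 hy))
          (mem_hyperplaneComplement.1 y.2 i)
      exact ((convex_halfSpace_lt hlin (b i)).segment_subset hx hy hz).ne
    · exact ((convex_halfSpace_gt hlin (b i)).segment_subset hx ((h i).1 hx) hz).ne'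
  have hpre : IsPreconnected
      ((↑) ⁻¹' segment ℝ (x : E) y : Set (hyperplaneComplement a b)) := by
    rw [← Topology.IsInducing.subtypeVal.isPreconnected_image, Subtype.image_preimage_coe,
      Set.inter_eq_right.2 hseg]
    exact (convex_segment _ _).isPreconnected
  rw [ConnectedComponents.coe_eq_coe']
  exact hpre.subset_connectedComponent (right_mem_segment ℝ (x : E) y)
    (left_mem_segment ℝ (x : E) y)

/-- Finitely many hyperplanes cut out finitely many regions. -/
instance finite_connectedComponents_hyperplaneComplement [Finite ι] :
    Finite (ConnectedComponents (hyperplaneComplement a b)) := by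
  refine Finite.of_injective (β := ι → Prop)
    (fun c i => b i < ⟪a i, ((Quotient.out c : hyperplaneComplement a b) : E)⟫) fun c c' h => ?_
  rw [← Quotient.out_eq c, ← Quotient.out_eq c']
  exact connectedComponents_eq_of_lt_inner_iff fun i => iff_of_eq (congrFun h i)

end Regions

theorem exists_hyperplanes_with_many_regions
    {d : ℕ} (hd : 1 ≤ d) (n : ℕ) :
    ∃ (a : Fin n → EuclideanSpace ℝ (Fin d)) (b : Fin n → ℝ),
      (∀ i, a i ≠ 0) ∧
      (n / d) ^ d ≤
        Nat.card
          (ConnectedComponents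
            ↥((⋃ i : Fin n, {x : EuclideanSpace ℝ (Fin d) | ⟪a i, x⟫ = b i})ᶜ)) := by
  let a : Fin n → EuclideanSpace ℝ (Fin d) := fun i =>
    EuclideanSpace.single ⟨i % d, Nat.mod_lt _ hd⟩ 1
  let b : Fin n → ℝ := fun i => ((i / d : ℕ) : ℝ)
  have hinner (i : Fin n) (x : EuclideanSpace ℝ (Fin d)) :
      ⟪a i, x⟫ = x ⟨i % d, Nat.mod_lt _ hd⟩ := by
    simp [a, EuclideanSpace.inner_single_left]
  refine ⟨a, b, fun i => by simp [a], ?_⟩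
  let p : (Fin d → Fin (n / d)) → EuclideanSpace ℝ (Fin d) := fun f =>
    WithLp.toLp 2 fun j => ((f j : ℕ) : ℝ) + 1 / 2
  have lt_add_half {k m : ℕ} : (k : ℝ) < m + 1 / 2 ↔ k ≤ m := by
    constructor
    · intro h
      have : (k : ℝ) < (m + 1 : ℕ) := by push_cast; linarith
      exact Nat.lt_succ_iff.1 (Nat.cast_lt.1 this)
    · intro h
      have : (k : ℝ) ≤ m := Nat.cast_le.2 h
      linarith
  have hp (f : Fin d → Fin (n / d)) : p f ∈ hyperplaneComplement a b := by
    rw [mem_hyperplaneComplement]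
    intro i h
    simp only [hinner, p, b] at h
    have h' : ((2 * f ⟨i % d, Nat.mod_lt _ hd⟩ + 1 : ℕ) : ℝ) = (2 * (i / d) : ℕ) := by
      push_cast at h ⊢
      linarith
    have := Nat.cast_injective h'
    omega
  have hinj : Function.Injective fun f =>
      ((⟨p f, hp f⟩ : hyperplaneComplement a b) :
        ConnectedComponents (hyperplaneComplement a b)) := by
    intro f g hfg
    have key (j : Fin d) (k : ℕ) (hk : k < n / d) : k ≤ f j ↔ k ≤ g j := by
      have hlt : j + d * k < n := by
        have h₁ : d * (k + 1) ≤ n := (Nat.mul_le_mul_left d hk).trans (Nat.mul_div_le n d)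
        have h₂ := j.2
        rw [Nat.mul_succ] at h₁
        omega
      have h := lt_inner_iff_of_connectedComponents_eq hfg ⟨j + d * k, hlt⟩
      simpa only [hinner, p, b, Nat.add_mul_mod_self_left, Nat.mod_eq_of_lt j.2,
        Nat.add_mul_div_left _ _ hd, Nat.div_eq_of_lt j.2, zero_add, lt_add_half] using h
    funext j
    exact Fin.ext (le_antisymm ((key j _ (f j).2).1 le_rfl) ((key j _ (g j).2).2 le_rfl))
  simpa using Nat.card_le_card_of_injective _ hinj
end

section
/- Let r : ℕ × ℕ → ℕ be a function satisfying: r(1, n) ≤ n + 1 for all n; r(d, 0) ≤ 1 for all d ≥ 1; and r(d+1, n+1) ≤ r(d+1, n) + r(d, n) for all d ≥ 1 and all n. Then for all d ≥ 1 and all n, r(d, n) ≤ n^d/d! + (n+1)^{d−1}. -/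
theorem pow_succ_add_mul_pow_le_add_one_pow {x : ℝ} (hx : 0 ≤ x) (d : ℕ) :
    x ^ (d + 1) + (d + 1) * x ^ d ≤ (x + 1) ^ (d + 1) := by
  induction d with
  | zero => simp
  | succ d ih =>
    have hmul := mul_le_mul_of_nonneg_right ih (by positivity : 0 ≤ x + 1)
    have hpow : 0 ≤ ((d : ℝ) + 1) * x ^ d := by positivity
    push_cast
    calc x ^ (d + 1 + 1) + ((d : ℝ) + 1 + 1) * x ^ (d + 1)
        ≤ (x ^ (d + 1) + (d + 1) * x ^ d) * (x + 1) := by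
          linear_combination hpow
      _ ≤ (x + 1) ^ (d + 1 + 1) := by rw [pow_succ (x + 1) (d + 1)]; exact hmul

theorem pow_succ_div_factorial_add_le {x : ℝ} (hx : 0 ≤ x) (d : ℕ) :
    x ^ (d + 1) / (d + 1).factorial + x ^ d / d.factorial
      ≤ (x + 1) ^ (d + 1) / (d + 1).factorial := by
  have hsplit : x ^ (d + 1) / (d + 1).factorial + x ^ d / d.factorial
      = (x ^ (d + 1) + (d + 1) * x ^ d) / (d + 1).factorial := by
    rw [Nat.factorial_succ]
    push_cast
    field_simp
  rw [hsplit]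
  gcongr
  exact pow_succ_add_mul_pow_le_add_one_pow hx d

theorem pow_succ_add_pow_le_add_one_pow {x : ℝ} (hx : 0 ≤ x) (k : ℕ) :
    x ^ (k + 1) + x ^ k ≤ (x + 1) ^ (k + 1) :=
  calc x ^ (k + 1) + x ^ k = x ^ k * (x + 1) := by ring
    _ ≤ (x + 1) ^ k * (x + 1) := by gcongr; linarith
    _ = (x + 1) ^ (k + 1) := (pow_succ _ _).symm

theorem region_recurrence_upper_bound
    (r : ℕ → ℕ → ℕ)
    (h1 : ∀ n : ℕ, r 1 n ≤ n + 1)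
    (h0 : ∀ d : ℕ, 1 ≤ d → r d 0 ≤ 1)
    (hrec : ∀ d : ℕ, 1 ≤ d → ∀ n : ℕ, r (d + 1) (n + 1) ≤ r (d + 1) n + r d n) :
    ∀ d : ℕ, 1 ≤ d → ∀ n : ℕ,
      (r d n : ℝ) ≤ (n : ℝ) ^ d / (Nat.factorial d) + ((n : ℝ) + 1) ^ (d - 1) := by
  intro d hd
  induction d, hd using Nat.le_induction with
  | base =>
    intro n
    simpa using (by exact_mod_cast h1 n : (r 1 n : ℝ) ≤ n + 1)
  | succ d hd ihd =>
    intro n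
    induction n with
    | zero => simpa using h0 (d + 1) (by omega)
    | succ n ihn =>
      obtain ⟨k, rfl⟩ := Nat.exists_eq_add_of_le' hd
      have hr : (r (k + 1 + 1) (n + 1) : ℝ) ≤ r (k + 1 + 1) n + r (k + 1) n := by
        exact_mod_cast hrec (k + 1) hd n
      have hn := ihd n
      have hfac := pow_succ_div_factorial_add_le (Nat.cast_nonneg (α := ℝ) n) (k + 1)
      have hpow := pow_succ_add_pow_le_add_one_pow (by positivity : (0 : ℝ) ≤ n + 1) k
      simp only [Nat.add_sub_cancel] at ihn hn ⊢
      push_cast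
      linarith
end

section
/- Let k ≥ 1 be an integer, let OPT ≥ 0 be a real number, and let f : ℕ → ℝ be a function satisfying f(1) ≥ OPT/k and f(t+1) ≥ f(t) + (OPT − f(t))/k for all t ≥ 1. Then f(k) ≥ (1 − 1/e) · OPT, where e is Euler's number. -/
/-- The gap to the optimum shrinks by a factor `1 - 1 / k` with every greedy selection. -/
theorem greedy_gap_le {k : ℕ} (hk : 1 ≤ k) {OPT : ℝ} {f : ℕ → ℝ}
    (h1 : f 1 ≥ OPT / k)
    (hrec : ∀ t : ℕ, 1 ≤ t → f (t + 1) ≥ f t + (OPT - f t) / k)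
    {t : ℕ} (ht : 1 ≤ t) : OPT - f t ≤ (1 - 1 / (k : ℝ)) ^ t * OPT := by
  have hk' : (1 : ℝ) ≤ k := by exact_mod_cast hk
  have hfactor : 0 ≤ 1 - 1 / (k : ℝ) :=
    sub_nonneg.mpr (div_le_one_of_le₀ hk' (by positivity))
  induction t, ht using Nat.le_induction with
  | base =>
    calc OPT - f 1 ≤ OPT - OPT / k := by linarith
      _ = (1 - 1 / (k : ℝ)) ^ 1 * OPT := by ring
  | succ t ht ih =>
    calc OPT - f (t + 1) ≤ OPT - (f t + (OPT - f t) / k) := by linarith [hrec t ht]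
      _ = (1 - 1 / (k : ℝ)) * (OPT - f t) := by ring
      _ ≤ (1 - 1 / (k : ℝ)) * ((1 - 1 / (k : ℝ)) ^ t * OPT) := by gcongr
      _ = (1 - 1 / (k : ℝ)) ^ (t + 1) * OPT := by ring

theorem greedy_coverage_one_sub_inv_e
    (k : ℕ) (hk : 1 ≤ k) (OPT : ℝ) (hOPT : 0 ≤ OPT) (f : ℕ → ℝ)
    (h1 : f 1 ≥ OPT / k)
    (hrec : ∀ t : ℕ, 1 ≤ t → f (t + 1) ≥ f t + (OPT - f t) / k) :
    f k ≥ (1 - 1 / Real.exp 1) * OPT := by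
  have hgap := greedy_gap_le hk h1 hrec hk
  have hexp : (1 - 1 / (k : ℝ)) ^ k ≤ 1 / Real.exp 1 := by
    rw [one_div (Real.exp 1), ← Real.exp_neg]
    exact Real.one_sub_div_pow_le_exp_neg (by exact_mod_cast hk)
  linarith [mul_le_mul_of_nonneg_right hexp hOPT]
end

section
/- Let n ≥ 1 and let S_1, …, S_m be subsets of {1, …, n}. In ℝ², for j ∈ {1, …, n} let B_j = [2(j−1), 2(j−1)+1] × [0, 1] be the unit square with bottom-left corner (2(j−1), 0), let D = {(x, 1/2) : 0 ≤ x ≤ 2n − 1} be a horizontal line segment, and let A_i = D ∪ ⋃_{j ∈ S_i} B_j. Then for every subset T ⊆ {1, …, m}, the two-dimensional Lebesgue measure of ⋃_{i ∈ T} A_i equals the cardinality |⋃_{i ∈ T} S_i|. -/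
open MeasureTheory

/-- The unit square `B_j` with bottom-left corner `(2 j, 0)` (using 0-based indexing). -/
def unitSquare (j : ℕ) : Set (ℝ × ℝ) :=
  Set.Icc (2 * (j : ℝ)) (2 * (j : ℝ) + 1) ×ˢ Set.Icc (0 : ℝ) 1

/-- The horizontal segment `D` from `(0, 1/2)` to `(2n - 1, 1/2)`. -/
def midSegment (n : ℕ) : Set (ℝ × ℝ) :=
  Set.Icc (0 : ℝ) (2 * (n : ℝ) - 1) ×ˢ {(1 / 2 : ℝ)}

/-- The region `A_i = D ∪ ⋃_{j ∈ S_i} B_j` associated with the set `S_i`. -/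
def coverRegion {n m : ℕ} (S : Fin m → Set (Fin n)) (i : Fin m) : Set (ℝ × ℝ) :=
  midSegment n ∪ ⋃ j ∈ S i, unitSquare (j : ℕ)

theorem volume_unitSquare (j : ℕ) : volume (unitSquare j) = 1 := by
  rw [unitSquare, Measure.volume_eq_prod, Measure.prod_prod]
  simp

theorem measurableSet_unitSquare (j : ℕ) : MeasurableSet (unitSquare j) :=
  measurableSet_Icc.prod measurableSet_Icc

theorem volume_midSegment (n : ℕ) : volume (midSegment n) = 0 := by
  simp [midSegment, Measure.volume_eq_prod, Measure.prod_prod]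

theorem le_of_mem_unitSquare {j k : ℕ} {p : ℝ × ℝ} (hj : p ∈ unitSquare j)
    (hk : p ∈ unitSquare k) : j ≤ k := by
  have h₁ := hj.1.1
  have h₂ := hk.1.2
  have h : 2 * j ≤ 2 * k + 1 := by exact_mod_cast h₁.trans h₂
  omega

theorem pairwise_disjoint_unitSquare : Pairwise (Function.onFun Disjoint unitSquare) :=
  fun _ _ hjk => Set.disjoint_left.2 fun _ hj hk =>
    hjk (le_antisymm (le_of_mem_unitSquare hj hk) (le_of_mem_unitSquare hk hj))

theorem volume_biUnion_unitSquare {n : ℕ} (U : Set (Fin n)) :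
    volume (⋃ j ∈ U, unitSquare (j : ℕ)) = (U.ncard : ENNReal) := by
  classical
  have hU : ⋃ j ∈ U, unitSquare (j : ℕ) = ⋃ j ∈ U.toFinset, unitSquare (j : ℕ) := by simp
  rw [hU, measure_biUnion_finset (f := fun j : Fin n => unitSquare j)
    (fun _ _ _ _ hjk => pairwise_disjoint_unitSquare (Fin.val_injective.ne hjk))
    fun j _ => measurableSet_unitSquare j]
  simp [volume_unitSquare, Set.ncard_eq_toFinset_card']

theorem volume_union_coverRegions_eq_card
    {n m : ℕ} (hn : 1 ≤ n) (S : Fin m → Set (Fin n)) (T : Set (Fin m)) :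
    volume (⋃ i ∈ T, coverRegion S i) = ((⋃ i ∈ T, S i).ncard : ENNReal) := by
  rw [← volume_biUnion_unitSquare]
  apply le_antisymm
  · calc volume (⋃ i ∈ T, coverRegion S i)
        ≤ volume (midSegment n ∪ ⋃ j ∈ ⋃ i ∈ T, S i, unitSquare (j : ℕ)) := by
          refine measure_mono (Set.iUnion₂_subset fun i hi => Set.union_subset_union_right _ ?_)
          exact Set.biUnion_subset_biUnion_left (Set.subset_biUnion_of_mem hi)
      _ ≤ volume (midSegment n) + volume (⋃ j ∈ ⋃ i ∈ T, S i, unitSquare (j : ℕ)) :=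
          measure_union_le _ _
      _ = volume (⋃ j ∈ ⋃ i ∈ T, S i, unitSquare (j : ℕ)) := by
          rw [volume_midSegment, zero_add]
  · refine measure_mono (Set.iUnion₂_subset fun j hj => ?_)
    obtain ⟨i, hi, hji⟩ := Set.mem_iUnion₂.1 hj
    exact fun p hp => Set.mem_iUnion₂.2 ⟨i, hi, Or.inr (Set.mem_iUnion₂.2 ⟨j, hji, hp⟩)⟩
end
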